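/- (Corollary 2) Let d ≥ 2 and n = d+1. For any symmetrical code that satisfies node regeneration, and for any ℓ ∈ [0:d−1], ℓ₁ ∈ [0:ℓ], and m ∈ [ℓ+1:d−1], one has T_{d,m,ℓ}^{−1} · H(U^{(ℓ₁,m)} | M^{(m)}) ≥ T_{d,m+1,ℓ}^{−1} · H(U^{(ℓ₁,m+1)} | M^{(m)}) + (T_{d,m,ℓ}^{−1} − T_{d,m+1,ℓ}^{−1}) · H(U^{(ℓ₁,ℓ)} | M^{(m)}). -/

import Mathlib

open scoped BigOperators Classical

namespace MDCSR

noncomputable section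

/-- `X` is a deterministic function of `Y`. -/
def IsFuncOf {Ω α β : Type*} (X : Ω → α) (Y : Ω → β) : Prop :=
  ∃ f : β → α, ∀ ω, X ω = f (Y ω)

variable {Ω V : Type} [Fintype Ω]

/-- Probability of the event `X = x` under the probability mass function `p`. -/
def pm (p : Ω → ℝ) {α : Type*} (X : Ω → α) (x : α) : ℝ :=
  ∑ ω ∈ Finset.univ.filter (fun ω' => X ω' = x), p ω

/-- Shannon entropy of the random variable `X` under the probability mass function `p`. -/
def H (p : Ω → ℝ) {α : Type*} (X : Ω → α) : ℝ :=
  -∑ ω, p ω * Real.log (pm p X (X ω))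

/-- An `(n = d+1, d)` code: messages `M 1, …, M d`, a key `K`, node contents
`W 1, …, W (d+1)`, and repair data `S i j` (data downloaded from node `i` to repair
node `j`), all random variables on a common finite probability space `(Ω, p)`.
The messages are mutually independent, the key is independent of the messages,
each `W i` is a deterministic function of the messages and the key, and each
`S i j` is a deterministic function of `W i`. -/
structure Code (Ω V : Type) [Fintype Ω] (d : ℕ) : Type where
  p : Ω → ℝ
  p_nonneg : ∀ ω, 0 ≤ p ω
  p_sum : ∑ ω, p ω = 1
  M : ℕ → Ω → V
  K : Ω → V
  W : ℕ → Ω → V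
  S : ℕ → ℕ → Ω → V
  M_indep : ∀ x : ℕ → V,
    pm p (fun ω (i : Fin d) => M (↑i + 1) ω) (fun i => x (↑i + 1)) =
      ∏ i ∈ Finset.Icc 1 d, pm p (M i) (x i)
  K_indep : ∀ (k : V) (x : ℕ → V),
    pm p (fun ω => (K ω, fun (i : Fin d) => M (↑i + 1) ω)) (k, fun i => x (↑i + 1)) =
      pm p K k * pm p (fun ω (i : Fin d) => M (↑i + 1) ω) (fun i => x (↑i + 1))
  W_func : ∀ i ∈ Finset.Icc 1 (d + 1),
    IsFuncOf (W i) (fun ω => ((fun (j : Fin d) => M (↑j + 1) ω), K ω))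
  S_func : ∀ i ∈ Finset.Icc 1 (d + 1), ∀ j ∈ Finset.Icc 1 (d + 1), i ≠ j →
    IsFuncOf (S i j) (W i)

/-- Descriptors for the basic random variables of a code. -/
inductive Atom where
  | M : ℕ → Atom
  | K : Atom
  | W : ℕ → Atom
  | S : ℕ → ℕ → Atom

variable {d : ℕ}

/-- The random variable described by an atom. -/
def Code.atomRV (C : Code Ω V d) : Atom → Ω → V
  | .M i => C.M i
  | .K => C.K
  | .W i => C.W i
  | .S i j => C.S i j

/-- The joint random variable (tuple) described by a list of atoms. -/
def Code.rv (C : Code Ω V d) (L : List Atom) : Ω → List V :=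
  fun ω => L.map fun a => C.atomRV a ω

/-- Joint entropy of a tuple of basic random variables. -/
def Code.HL (C : Code Ω V d) (L : List Atom) : ℝ := H C.p (C.rv L)

/-- Conditional entropy `H(L₁ | L₂)`. -/
def Code.CH (C : Code Ω V d) (L₁ L₂ : List Atom) : ℝ := C.HL (L₁ ++ L₂) - C.HL L₂

/-- Mutual information `I(L₁ ; L₂)`. -/
def Code.MI (C : Code Ω V d) (L₁ L₂ : List Atom) : ℝ :=
  C.HL L₁ + C.HL L₂ - C.HL (L₁ ++ L₂)

/-- Relabeling of an atom along a permutation of the storage-node indices. -/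
def Atom.perm (π : Equiv.Perm ℕ) : Atom → Atom
  | .M i => .M i
  | .K => .K
  | .W i => .W (π i)
  | .S i j => .S (π i) (π j)

/-- A code is symmetrical if every joint entropy of a tuple of the basic random
variables is invariant under every permutation of the storage-node indices `[1:n]`. -/
def Code.Symmetrical (C : Code Ω V d) : Prop :=
  ∀ π : Equiv.Perm ℕ, (∀ i ∈ Finset.Icc 1 (d + 1), π i ∈ Finset.Icc 1 (d + 1)) →
    ∀ L : List Atom, C.HL (L.map (Atom.perm π)) = C.HL L

/-- The list `[a, a+1, …, b]`. -/
def icc (a b : ℕ) : List ℕ := List.range' a (b + 1 - a)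

/-- `W_A` as a list of atoms. -/
def Ws (A : List ℕ) : List Atom := A.map Atom.W

/-- `M_A` as a list of atoms. -/
def MsL (A : List ℕ) : List Atom := A.map Atom.M

/-- `M^{(m)} = (M_1, …, M_m)`. -/
def Mup (m : ℕ) : List Atom := MsL (icc 1 m)

/-- `S_{B → j}`. -/
def Sto (B : List ℕ) (j : ℕ) : List Atom := B.map fun i => Atom.S i j

/-- `S_{i → B}`. -/
def Sfrom (i : ℕ) (B : List ℕ) : List Atom := B.map fun j => Atom.S i j

/-- `S̄_{→ j} = S_{[j+1:n] → j}` (here `n = d+1`). -/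
def SbarTo (d j : ℕ) : List Atom := Sto (icc (j + 1) (d + 1)) j

/-- `S̄_{→ A}`. -/
def SbarToL (d : ℕ) (A : List ℕ) : List Atom := (A.map (SbarTo d)).flatten

/-- `S̲_{→ j} = S_{[1:j-1] → j}`. -/
def SunderTo (j : ℕ) : List Atom := Sto (icc 1 (j - 1)) j

/-- `S̲_{→ A}`. -/
def SunderToL (A : List ℕ) : List Atom := (A.map SunderTo).flatten

/-- `S_{→ j} = S_{([1:n] ∖ {j}) → j}` (here `n = d+1`). -/
def StoFull (d j : ℕ) : List Atom := Sto ((icc 1 (d + 1)).filter (fun i => i ≠ j)) j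

/-- `(S_{→ j} : j ∈ A)`. -/
def StoFullL (d : ℕ) (A : List ℕ) : List Atom := (A.map (StoFull d)).flatten

/-- `U^{(t,s)} = (W_{[1:t]}, S̄_{→[t+1:s]})`. -/
def U (d t s : ℕ) : List Atom := Ws (icc 1 t) ++ SbarToL d (icc (t + 1) s)

/-- Node regeneration: each `W j` is a deterministic function of `S_{→ j}`. -/
def Code.NodeRegen (C : Code Ω V d) : Prop :=
  ∀ j ∈ Finset.Icc 1 (d + 1), IsFuncOf (C.W j) (C.rv (StoFull d j))

/-- Message recovery for parameter `ℓ`: `M j` is constant for `j ∈ [1:ℓ]`, and for every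
`A ⊆ [1:n]` with `|A| ∈ [ℓ+1:d]`, `M_{|A|}` is a deterministic function of `W_A`. -/
def Code.MsgRecovery (C : Code Ω V d) (ℓ : ℕ) : Prop :=
  (∀ j ∈ Finset.Icc 1 ℓ, ∃ c : V, ∀ ω, C.M j ω = c) ∧
  ∀ A : Finset ℕ, A ⊆ Finset.Icc 1 (d + 1) → A.card ∈ Finset.Icc (ℓ + 1) d →
    IsFuncOf (C.M A.card) (C.rv (Ws (A.sort (· ≤ ·))))

/-- Repair secrecy for parameters `ℓ₁, ℓ₂`: for all disjoint `E₁, E₂ ⊆ [1:n]` with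
`|E₁| = ℓ₁`, `|E₂| = ℓ₂`, the messages `M_{ℓ+1}, …, M_d` are independent of
`((W_i : i ∈ E₁), (S_{→j} : j ∈ E₂))`, where `ℓ = ℓ₁ + ℓ₂`. -/
def Code.RepairSecrecy (C : Code Ω V d) (ℓ₁ ℓ₂ : ℕ) : Prop :=
  ∀ E₁ E₂ : Finset ℕ, E₁ ⊆ Finset.Icc 1 (d + 1) → E₂ ⊆ Finset.Icc 1 (d + 1) →
    Disjoint E₁ E₂ → E₁.card = ℓ₁ → E₂.card = ℓ₂ →
    C.MI (MsL (icc (ℓ₁ + ℓ₂ + 1) d))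
      (Ws (E₁.sort (· ≤ ·)) ++ StoFullL d (E₂.sort (· ≤ ·))) = 0

/-- `T_{d,k,ℓ} = Σ_{t=ℓ+1}^{k} (d+1−t)`, as a real number. -/
def T (d k ℓ : ℕ) : ℝ := ∑ t ∈ Finset.Icc (ℓ + 1) k, ((d : ℝ) + 1 - (t : ℝ))


lemma pm_pos (p : Ω → ℝ) (hp : ∀ ω, 0 ≤ p ω) {α : Type*} (X : Ω → α) {ω : Ω}
    (hω : 0 < p ω) : 0 < pm p X (X ω) :=
  hω.trans_le (Finset.single_le_sum (f := p) (fun i _ => hp i) (by simp))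

lemma pm_nonneg (p : Ω → ℝ) (hp : ∀ ω, 0 ≤ p ω) {α : Type*} (X : Ω → α) (x : α) :
    0 ≤ pm p X x :=
  Finset.sum_nonneg fun i _ => hp i

/-- Entropy is monotone: a variable constant on the fibres of `Y` has entropy at most `H Y`. -/
lemma H_le_of_ker (p : Ω → ℝ) (hp : ∀ ω, 0 ≤ p ω) {α β : Type*} (X : Ω → α) (Y : Ω → β)
    (h : ∀ ω ω', Y ω = Y ω' → X ω = X ω') : H p X ≤ H p Y := by
  unfold H
  refine neg_le_neg (Finset.sum_le_sum fun ω _ => ?_)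
  rcases (hp ω).eq_or_lt with h0 | h0
  · simp [← h0]
  · refine mul_le_mul_of_nonneg_left (Real.log_le_log (pm_pos p hp Y h0) ?_) h0.le
    refine Finset.sum_le_sum_of_subset_of_nonneg (fun i hi => ?_) fun i _ _ => hp i
    simp only [Finset.mem_filter, Finset.mem_univ, true_and] at hi ⊢
    exact h _ _ hi

/-- Submodularity of entropy, where `D` is equivalent to the pair `(A, B)` and `Z` is a common
function of `A` and `B`. -/
lemma H_submodular (p : Ω → ℝ) (hp : ∀ ω, 0 ≤ p ω) (hs : ∑ ω, p ω = 1)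
    {α β γ δ : Type*} (A : Ω → α) (B : Ω → β) (Z : Ω → γ) (D : Ω → δ)
    (hAZ : ∀ ω ω', A ω = A ω' → Z ω = Z ω') (hBZ : ∀ ω ω', B ω = B ω' → Z ω = Z ω')
    (hD : ∀ ω ω', D ω = D ω' ↔ A ω = A ω' ∧ B ω = B ω') :
    H p D + H p Z ≤ H p A + H p B := by
  have hpoint : ∀ ω, p ω * (Real.log (pm p A (A ω)) + Real.log (pm p B (B ω))
      - Real.log (pm p D (D ω)) - Real.log (pm p Z (Z ω))) ≤
      p ω / (pm p D (D ω) * pm p Z (Z ω)) * (pm p A (A ω) * pm p B (B ω)) - p ω := by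
    intro ω
    rcases (hp ω).eq_or_lt with h0 | h0
    · simp [← h0]
    · have a := pm_pos p hp A h0
      have b := pm_pos p hp B h0
      have c := pm_pos p hp D h0
      have e := pm_pos p hp Z h0
      have := Real.log_le_sub_one_of_pos
        (div_pos (mul_pos a b) (mul_pos c e))
      rw [Real.log_div (mul_pos a b).ne' (mul_pos c e).ne', Real.log_mul a.ne' b.ne',
        Real.log_mul c.ne' e.ne'] at this
      calc _ ≤ p ω * (pm p A (A ω) * pm p B (B ω) / (pm p D (D ω) * pm p Z (Z ω)) - 1) :=
            mul_le_mul_of_nonneg_left (by linarith) h0.le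
        _ = _ := by ring
  have hinner : ∀ ω₁ ω₂, (∑ ω, p ω / (pm p D (D ω) * pm p Z (Z ω)) *
      ((if A ω₁ = A ω then 1 else 0) * (if B ω₂ = B ω then 1 else 0))) ≤
      if Z ω₂ = Z ω₁ then (pm p Z (Z ω₁))⁻¹ else 0 := by
    intro ω₁ ω₂
    by_cases hex : ∃ ω₀, A ω₁ = A ω₀ ∧ B ω₂ = B ω₀
    · obtain ⟨ω₀, h1, h2⟩ := hex
      have z1 := hAZ _ _ h1
      have z2 := hBZ _ _ h2
      rw [if_pos (z2.trans z1.symm)]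
      have : ∀ ω, p ω / (pm p D (D ω) * pm p Z (Z ω)) *
          ((if A ω₁ = A ω then 1 else 0) * (if B ω₂ = B ω then 1 else 0)) =
          if D ω = D ω₀ then p ω * ((pm p D (D ω₀))⁻¹ * (pm p Z (Z ω₁))⁻¹) else 0 := by
        intro ω
        by_cases hω : D ω = D ω₀
        · obtain ⟨h3, h4⟩ := (hD _ _).1 hω
          rw [if_pos hω, if_pos (h1.trans h3.symm), if_pos (h2.trans h4.symm), hω,
            hAZ _ _ h3, ← z1]
          rw [div_eq_mul_inv, mul_inv]; ring
        · rw [if_neg hω]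
          by_cases h3 : A ω₁ = A ω
          · have h4 : ¬ B ω₂ = B ω := fun h4 =>
              hω ((hD _ _).2 ⟨h3.symm.trans h1, h4.symm.trans h2⟩)
            simp [h4]
          · simp [h3]
      rw [Finset.sum_congr rfl fun ω _ => this ω, ← Finset.sum_filter, ← Finset.sum_mul]
      change pm p D (D ω₀) * _ ≤ _
      rw [← mul_assoc]
      exact mul_le_of_le_one_left (inv_nonneg.2 (pm_nonneg p hp _ _)) mul_inv_le_one
    · rw [Finset.sum_eq_zero]
      · split_ifs
        · exact inv_nonneg.2 (pm_nonneg p hp _ _)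
        · exact le_rfl
      · intro ω _
        by_cases h3 : A ω₁ = A ω
        · have h4 : ¬ B ω₂ = B ω := fun h4 => hex ⟨ω, h3, h4⟩
          simp [h4]
        · simp [h3]
  have htotal : ∑ ω, p ω / (pm p D (D ω) * pm p Z (Z ω)) * (pm p A (A ω) * pm p B (B ω)) ≤ 1 := by
    calc ∑ ω, p ω / (pm p D (D ω) * pm p Z (Z ω)) * (pm p A (A ω) * pm p B (B ω))
        = ∑ ω, ∑ ω₁, ∑ ω₂, p ω₁ * (p ω₂ * (p ω / (pm p D (D ω) * pm p Z (Z ω)) *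
          ((if A ω₁ = A ω then 1 else 0) * (if B ω₂ = B ω then 1 else 0)))) := by
          refine Finset.sum_congr rfl fun ω _ => ?_
          have hA : pm p A (A ω) = ∑ ω₁, p ω₁ * (if A ω₁ = A ω then 1 else 0) := by
            simp [pm, Finset.sum_filter]
          have hB : pm p B (B ω) = ∑ ω₁, p ω₁ * (if B ω₁ = B ω then 1 else 0) := by
            simp [pm, Finset.sum_filter]
          rw [hA, hB, Finset.sum_mul_sum, Finset.mul_sum]
          refine Finset.sum_congr rfl fun ω₁ _ => ?_
          rw [Finset.mul_sum]
          exact Finset.sum_congr rfl fun ω₂ _ => by ring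
      _ = ∑ ω₁, p ω₁ * ∑ ω₂, p ω₂ * ∑ ω, p ω / (pm p D (D ω) * pm p Z (Z ω)) *
          ((if A ω₁ = A ω then 1 else 0) * (if B ω₂ = B ω then 1 else 0)) := by
          rw [Finset.sum_comm]
          refine Finset.sum_congr rfl fun ω₁ _ => ?_
          rw [Finset.sum_comm, Finset.mul_sum]
          refine Finset.sum_congr rfl fun ω₂ _ => ?_
          rw [Finset.mul_sum, Finset.mul_sum]
      _ ≤ ∑ ω₁, p ω₁ * ∑ ω₂, p ω₂ * (if Z ω₂ = Z ω₁ then (pm p Z (Z ω₁))⁻¹ else 0) := by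
          gcongr with ω₁ _ ω₂ _
          · exact hp ω₁
          · exact hp ω₂
          · exact hinner ω₁ ω₂
      _ ≤ ∑ ω₁, p ω₁ * 1 := by
          gcongr with ω₁ _
          · exact hp ω₁
          · simp only [mul_ite, mul_zero]
            rw [← Finset.sum_filter, ← Finset.sum_mul]
            exact mul_inv_le_one
      _ = 1 := by simpa using hs
  have hsum := Finset.sum_le_sum fun ω (_ : ω ∈ Finset.univ) => hpoint ω
  simp only [mul_add, mul_sub, Finset.sum_sub_distrib, Finset.sum_add_distrib] at hsum
  unfold H
  linarith

lemma Code.rv_eq_iff (C : Code Ω V d) (L : List Atom) (ω ω' : Ω) :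
    C.rv L ω = C.rv L ω' ↔ ∀ a ∈ L, C.atomRV a ω = C.atomRV a ω' := by
  simp [Code.rv, List.map_inj_left]

lemma Code.HL_congr (C : Code Ω V d) {L L' : List Atom} (h : ∀ a, a ∈ L ↔ a ∈ L') :
    C.HL L = C.HL L' := by
  refine le_antisymm (H_le_of_ker _ C.p_nonneg _ _ ?_) (H_le_of_ker _ C.p_nonneg _ _ ?_) <;>
  · intro ω ω'
    simp only [C.rv_eq_iff, h, imp_self]

lemma Code.HL_submodular (C : Code Ω V d) {A B Z D : List Atom}
    (hA : ∀ ω ω', C.rv A ω = C.rv A ω' → C.rv Z ω = C.rv Z ω')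
    (hB : ∀ ω ω', C.rv B ω = C.rv B ω' → C.rv Z ω = C.rv Z ω')
    (hD : ∀ a, a ∈ D ↔ a ∈ A ∨ a ∈ B) :
    C.HL D + C.HL Z ≤ C.HL A + C.HL B := by
  refine H_submodular _ C.p_nonneg C.p_sum _ _ _ _ hA hB fun ω ω' => ?_
  simp only [C.rv_eq_iff, hD, or_imp, forall_and]

/-- If every element of `X` increases the entropy of `B` by at most `e`, then `X` increases it by
at most `e` times the length of `X`. -/
lemma Code.HL_append_le (C : Code Ω V d) (B : List Atom) (e : ℝ) (X : List Atom)
    (h : ∀ a ∈ X, C.HL (a :: B) ≤ C.HL B + e) :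
    C.HL (X ++ B) ≤ C.HL B + X.length * e := by
  induction X with
  | nil => simp
  | cons a X ih =>
    have h1 := ih fun b hb => h b (List.mem_cons_of_mem _ hb)
    have h2 := h a List.mem_cons_self
    have h3 : C.HL (a :: X ++ B) + C.HL B ≤ C.HL (a :: B) + C.HL (X ++ B) := by
      apply C.HL_submodular
      · intro ω ω'
        simp only [C.rv_eq_iff, List.mem_cons]
        exact fun H b hb => H b (Or.inr hb)
      · intro ω ω'
        simp only [C.rv_eq_iff, List.mem_append]
        exact fun H b hb => H b (Or.inr hb)
      · intro b
        simp only [List.mem_append, List.mem_cons]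
        tauto
    push_cast [List.length_cons]
    linarith

lemma mem_icc {a b x : ℕ} : x ∈ icc a b ↔ a ≤ x ∧ x ≤ b := by
  simp only [icc, List.mem_range'_1]
  omega

lemma mem_U {t s : ℕ} {a : Atom} : a ∈ U d t s ↔ (∃ i, (1 ≤ i ∧ i ≤ t) ∧ .W i = a) ∨
    ∃ j, (t + 1 ≤ j ∧ j ≤ s) ∧ ∃ i, (j + 1 ≤ i ∧ i ≤ d + 1) ∧ .S i j = a := by
  simp [U, Ws, SbarToL, SbarTo, Sto, mem_icc]

lemma mem_Mup {m : ℕ} {a : Atom} : a ∈ Mup m ↔ ∃ i, (1 ≤ i ∧ i ≤ m) ∧ .M i = a := by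
  simp [Mup, MsL, mem_icc]

lemma mem_Sto {B : List ℕ} {j : ℕ} {a : Atom} : a ∈ Sto B j ↔ ∃ i ∈ B, .S i j = a := by
  simp [Sto]

/-- `U^{(t,s)}` determines `W_1, …, W_s` by successive regeneration. -/
lemma Code.W_eq_of_U (C : Code Ω V d) (hregen : C.NodeRegen) {t s : ℕ} (hs : s ≤ d + 1)
    {ω ω' : Ω} (h : ∀ a ∈ U d t s, C.atomRV a ω = C.atomRV a ω') (j : ℕ) (h1 : 1 ≤ j)
    (hj : j ≤ s) : C.W j ω = C.W j ω' := by
  induction j using Nat.strong_induction_on with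
  | _ j ih =>
    by_cases hjt : j ≤ t
    · exact h (.W j) (mem_U.2 (Or.inl ⟨j, ⟨h1, hjt⟩, rfl⟩))
    · obtain ⟨f, hf⟩ := hregen j (Finset.mem_Icc.2 ⟨h1, by omega⟩)
      rw [hf, hf]
      congr 1
      rw [C.rv_eq_iff]
      intro a ha
      simp only [StoFull, Sto, List.mem_map, List.mem_filter, mem_icc, decide_eq_true_eq] at ha
      obtain ⟨i, ⟨⟨hi1, hi2⟩, hij⟩, rfl⟩ := ha
      rcases lt_or_gt_of_ne hij with hlt | hgt
      · obtain ⟨g, hg⟩ := C.S_func i (Finset.mem_Icc.2 ⟨hi1, hi2⟩) j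
          (Finset.mem_Icc.2 ⟨h1, by omega⟩) hij
        change C.S i j ω = C.S i j ω'
        rw [hg, hg, ih i hlt hi1 (by omega)]
      · exact h _ (mem_U.2 (Or.inr ⟨j, ⟨by omega, hj⟩, i, ⟨hgt, hi2⟩, rfl⟩))

lemma Atom.perm_swap_perm_swap (x y : ℕ) (a : Atom) :
    (a.perm (Equiv.swap x y)).perm (Equiv.swap x y) = a := by
  cases a <;> simp [Atom.perm]

lemma perm_swap_mem_U {t k x y : ℕ} (htk : t ≤ k) (hx : k < x) (hy : k < y)
    (hx' : x ≤ d + 1) (hy' : y ≤ d + 1) {a : Atom} (ha : a ∈ U d t k) :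
    a.perm (Equiv.swap x y) ∈ U d t k := by
  rw [mem_U] at ha ⊢
  rcases ha with ⟨i, hi, rfl⟩ | ⟨j, hj, i, hi, rfl⟩
  · refine Or.inl ⟨i, hi, ?_⟩
    rw [Atom.perm, Equiv.swap_apply_of_ne_of_ne] <;> omega
  · refine Or.inr ⟨j, hj, Equiv.swap x y i, ?_, ?_⟩
    · rw [Equiv.swap_apply_def]
      split_ifs <;> omega
    · rw [Atom.perm, Equiv.swap_apply_of_ne_of_ne (a := x) (b := y) (x := j)] <;> omega

/-- Swapping two nodes outside `[1:k]` leaves entropies joint with `U^{(t,k)}` and `M^{(m)}`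
unchanged. -/
lemma Code.HL_swap (C : Code Ω V d) (hsym : C.Symmetrical) {t k m x y : ℕ} (htk : t ≤ k)
    (hx : k < x) (hy : k < y) (hx' : x ≤ d + 1) (hy' : y ≤ d + 1) (L : List Atom) :
    C.HL (L.map (Atom.perm (Equiv.swap x y)) ++ (U d t k ++ Mup m)) =
      C.HL (L ++ (U d t k ++ Mup m)) := by
  have hB : ∀ a ∈ U d t k ++ Mup m, a.perm (Equiv.swap x y) ∈ U d t k ++ Mup m := by
    intro a ha
    rw [List.mem_append] at ha ⊢
    refine ha.imp (perm_swap_mem_U htk hx hy hx' hy') fun h => ?_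
    obtain ⟨i, hi, rfl⟩ := mem_Mup.1 h
    exact h
  rw [← hsym (Equiv.swap x y) _ (L ++ (U d t k ++ Mup m))]
  · apply C.HL_congr
    intro a
    rw [List.map_append, List.mem_append (s := L.map _), List.mem_append (s := L.map _)]
    refine or_congr Iff.rfl ⟨fun h => List.mem_map.2 ⟨_, hB a h, ?_⟩, fun h => ?_⟩
    · exact Atom.perm_swap_perm_swap x y a
    · obtain ⟨b, hb, rfl⟩ := List.mem_map.1 h
      exact hB b hb
  · intro i hi
    rw [Finset.mem_Icc] at hi ⊢
    rw [Equiv.swap_apply_def]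
    split_ifs <;> omega

lemma mem_U_succ {t k : ℕ} (htk : t ≤ k) {a : Atom} :
    a ∈ U d t (k + 1) ↔ a ∈ Sto (icc (k + 2) (d + 1)) (k + 1) ∨ a ∈ U d t k := by
  simp only [mem_U, mem_Sto, mem_icc]
  constructor
  · rintro (h | ⟨j, hj, i, hi, rfl⟩)
    · exact Or.inr (Or.inl h)
    · rcases Nat.lt_or_ge k j with h | h
      · obtain rfl : j = k + 1 := by omega
        exact Or.inl ⟨i, hi, rfl⟩
      · exact Or.inr (Or.inr ⟨j, ⟨hj.1, h⟩, i, hi, rfl⟩)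
  · rintro (⟨i, hi, rfl⟩ | h | ⟨j, hj, i, hi, rfl⟩)
    · exact Or.inr ⟨k + 1, by omega, i, hi, rfl⟩
    · exact Or.inl h
    · exact Or.inr ⟨j, by omega, i, hi, rfl⟩

/-- The normalised entropy increments along `k ↦ U^{(t,k)}` are nonincreasing. -/
lemma Code.increment_antitone (C : Code Ω V d) (hsym : C.Symmetrical) (hregen : C.NodeRegen)
    {t k m : ℕ} (htk : t ≤ k) (hk : k + 2 ≤ d) :
    ((d : ℝ) - k) * (C.CH (U d t (k + 2)) (Mup m) - C.CH (U d t (k + 1)) (Mup m)) ≤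
      ((d : ℝ) - k - 1) * (C.CH (U d t (k + 1)) (Mup m) - C.CH (U d t k) (Mup m)) := by
  have hU : ∀ a, a ∈ U d t (k + 1) ++ Mup m ↔
      a ∈ Sto (icc (k + 2) (d + 1)) (k + 1) ++ (U d t k ++ Mup m) := by
    intro a
    simp only [List.mem_append, mem_U_succ htk, or_assoc]
  have hmono := C.HL_append_le (U d t k ++ Mup m)
    (C.HL (.S (k + 2) (k + 1) :: (U d t k ++ Mup m)) - C.HL (U d t k ++ Mup m))
    (Sto (icc (k + 2) (d + 1)) (k + 1)) (by
      intro a ha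
      obtain ⟨i, hi, rfl⟩ := mem_Sto.1 ha
      rw [mem_icc] at hi
      have := C.HL_swap hsym (m := m) (x := k + 2) (y := i) htk (by omega) (by omega)
        (by omega) hi.2 [.S (k + 2) (k + 1)]
      rw [List.map_singleton, Atom.perm, Equiv.swap_apply_left,
        Equiv.swap_apply_of_ne_of_ne (by omega) (by omega)] at this
      simp only [List.singleton_append] at this
      rw [this]
      linarith)
  rw [← C.HL_congr hU] at hmono
  have hlen : ((Sto (icc (k + 2) (d + 1)) (k + 1)).length : ℝ) = (d : ℝ) - k := by
    rw [← Nat.cast_sub (by omega)]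
    simp only [Sto, icc, List.length_map, List.length_range']
    congr 1
    omega
  rw [hlen] at hmono
  have hsub : C.HL (.S (k + 1) (k + 2) :: (U d t (k + 2) ++ Mup m)) +
      C.HL (.S (k + 1) (k + 2) :: (U d t k ++ Mup m)) ≤
      C.HL (Sto (icc (k + 3) (d + 1)) (k + 2) ++ [.S (k + 1) (k + 2)] ++ (U d t k ++ Mup m)) +
      C.HL (U d t (k + 1) ++ Mup m) := by
    apply C.HL_submodular
    · intro ω ω'
      simp only [C.rv_eq_iff, List.mem_cons, List.mem_append, List.mem_nil_iff, or_false]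
      exact fun H a ha => H a (by tauto)
    · intro ω ω'
      simp only [C.rv_eq_iff, List.mem_cons, List.mem_append]
      rintro H a (rfl | ha | ha)
      · obtain ⟨g, hg⟩ := C.S_func (k + 1) (Finset.mem_Icc.2 (by omega)) (k + 2)
          (Finset.mem_Icc.2 (by omega)) (by omega)
        change C.S (k + 1) (k + 2) ω = C.S (k + 1) (k + 2) ω'
        rw [hg, hg, C.W_eq_of_U hregen (by omega) (fun a ha => H a (Or.inl ha)) (k + 1)
          (by omega) le_rfl]
      · exact H a (Or.inl ((mem_U_succ htk).2 (Or.inr ha)))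
      · exact H a (Or.inr ha)
    · intro a
      simp only [List.mem_cons, List.mem_append, List.mem_nil_iff, or_false,
        mem_U_succ (d := d) (show t ≤ k + 1 by omega), mem_U_succ (d := d) htk]
      tauto
  have hdrop : C.HL (U d t (k + 2) ++ Mup m) ≤
      C.HL (.S (k + 1) (k + 2) :: (U d t (k + 2) ++ Mup m)) := by
    refine H_le_of_ker _ C.p_nonneg _ _ fun ω ω' => ?_
    simp only [C.rv_eq_iff]
    exact fun H a ha => H a (List.mem_cons_of_mem _ ha)
  have hswap := C.HL_swap hsym (d := d) (m := m) (x := k + 1) (y := k + 2) htk (by omega)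
    (by omega) (by omega) (by omega)
  have hZ := hswap [.S (k + 2) (k + 1)]
  rw [List.map_singleton, Atom.perm, Equiv.swap_apply_left, Equiv.swap_apply_right] at hZ
  simp only [List.singleton_append] at hZ
  have hA := hswap (Sto (icc (k + 3) (d + 1)) (k + 1) ++ [.S (k + 2) (k + 1)])
  have hmap : (Sto (icc (k + 3) (d + 1)) (k + 1)).map (Atom.perm (Equiv.swap (k + 1) (k + 2))) =
      Sto (icc (k + 3) (d + 1)) (k + 2) := by
    simp only [Sto, List.map_map]
    refine List.map_congr_left fun i hi => ?_
    rw [mem_icc] at hi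
    rw [Function.comp_apply, Atom.perm, Equiv.swap_apply_left,
      Equiv.swap_apply_of_ne_of_ne (by omega) (by omega)]
  rw [List.map_append, List.map_singleton, hmap, Atom.perm, Equiv.swap_apply_left,
    Equiv.swap_apply_right] at hA
  have hA' : C.HL (Sto (icc (k + 3) (d + 1)) (k + 1) ++ [.S (k + 2) (k + 1)] ++
      (U d t k ++ Mup m)) = C.HL (U d t (k + 1) ++ Mup m) := by
    apply C.HL_congr
    intro a
    rw [hU]
    simp only [List.mem_append, List.mem_singleton, mem_Sto, mem_icc]
    refine or_congr ⟨?_, ?_⟩ Iff.rfl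
    · rintro (⟨i, hi, rfl⟩ | rfl)
      · exact ⟨i, by omega, rfl⟩
      · exact ⟨k + 2, by omega, rfl⟩
    · rintro ⟨i, hi, rfl⟩
      rcases hi.1.eq_or_lt with h | h
      · exact Or.inr (by rw [h])
      · exact Or.inl ⟨i, ⟨h, hi.2⟩, rfl⟩
  have hk' : (0 : ℝ) ≤ (d : ℝ) - k := by
    rw [sub_nonneg]
    exact_mod_cast (by omega : k ≤ d)
  have hstep : C.HL (U d t (k + 2) ++ Mup m) - C.HL (U d t (k + 1) ++ Mup m) ≤
      C.HL (U d t (k + 1) ++ Mup m) - C.HL (.S (k + 2) (k + 1) :: (U d t k ++ Mup m)) := by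
    linarith
  have := mul_le_mul_of_nonneg_left hstep hk'
  unfold Code.CH
  linarith

lemma T_succ {k ℓ : ℕ} (h : ℓ ≤ k) : T d (k + 1) ℓ = T d k ℓ + ((d : ℝ) - k) := by
  unfold T
  rw [Finset.sum_Icc_succ_top (by omega)]
  push_cast
  ring

lemma T_self (ℓ : ℕ) : T d ℓ ℓ = 0 := by
  simp [T]

lemma T_pos {k ℓ : ℕ} (h : ℓ < k) (hk : k ≤ d) : 0 < T d k ℓ := by
  refine Finset.sum_pos (fun t ht => ?_) ⟨k, Finset.mem_Icc.2 ⟨h, le_rfl⟩⟩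
  have : (t : ℝ) ≤ d := by exact_mod_cast (Finset.mem_Icc.1 ht).2.trans hk
  linarith

/-- The next increment is at most the average increment so far, with weights `d - k`. -/
lemma Code.increment_le_average (C : Code Ω V d) (hsym : C.Symmetrical) (hregen : C.NodeRegen)
    {t ℓ k m : ℕ} (htl : t ≤ ℓ) (hlk : ℓ ≤ k) (hk : k + 1 ≤ d) :
    (C.CH (U d t (k + 1)) (Mup m) - C.CH (U d t k) (Mup m)) * T d k ℓ ≤
      ((d : ℝ) - k) * (C.CH (U d t k) (Mup m) - C.CH (U d t ℓ) (Mup m)) := by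
  induction k, hlk using Nat.le_induction with
  | base => simp [T_self]
  | succ k hlk ih =>
    have h1 := ih (by omega)
    have h2 := C.increment_antitone hsym hregen (m := m) (htl.trans hlk) hk
    have hd : (0 : ℝ) < (d : ℝ) - k - 1 := by
      have : ((k + 2 : ℕ) : ℝ) ≤ d := by exact_mod_cast hk
      push_cast at this
      linarith
    have hT := (T_pos (d := d) (show ℓ < k + 1 by omega) (by omega)).le
    rw [T_succ hlk] at hT ⊢
    have h3 := mul_le_mul_of_nonneg_right h2 hT
    have h4 := mul_le_mul_of_nonneg_left h1 hd.le
    refine le_of_mul_le_mul_left ?_ (show (0 : ℝ) < (d : ℝ) - k by linarith)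
    push_cast
    linarith

theorem statement8 {Ω V : Type} [Fintype Ω] {d : ℕ} (hd : 2 ≤ d)
    (C : Code Ω V d) (hsym : C.Symmetrical) (hregen : C.NodeRegen)
    {ℓ ℓ₁ m : ℕ} (hℓ : ℓ ∈ Finset.Icc 0 (d - 1)) (hℓ₁ : ℓ₁ ∈ Finset.Icc 0 ℓ)
    (hm : m ∈ Finset.Icc (ℓ + 1) (d - 1)) :
    (T d m ℓ)⁻¹ * C.CH (U d ℓ₁ m) (Mup m)
      ≥ (T d (m + 1) ℓ)⁻¹ * C.CH (U d ℓ₁ (m + 1)) (Mup m)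
        + ((T d m ℓ)⁻¹ - (T d (m + 1) ℓ)⁻¹) * C.CH (U d ℓ₁ ℓ) (Mup m) := by
  rw [Finset.mem_Icc] at hℓ hℓ₁ hm
  have h := C.increment_le_average hsym hregen (m := m) hℓ₁.2 (show ℓ ≤ m by omega) (by omega)
  have hT := T_pos (d := d) (show ℓ < m by omega) (by omega)
  have hT' := T_pos (d := d) (show ℓ < m + 1 by omega) (by omega)
  have hsucc := T_succ (d := d) (show ℓ ≤ m by omega)
  rw [ge_iff_le, ← sub_nonneg]
  have key : (T d m ℓ)⁻¹ * C.CH (U d ℓ₁ m) (Mup m) -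
      ((T d (m + 1) ℓ)⁻¹ * C.CH (U d ℓ₁ (m + 1)) (Mup m)
        + ((T d m ℓ)⁻¹ - (T d (m + 1) ℓ)⁻¹) * C.CH (U d ℓ₁ ℓ) (Mup m)) =
      (((d : ℝ) - m) * (C.CH (U d ℓ₁ m) (Mup m) - C.CH (U d ℓ₁ ℓ) (Mup m)) -
        (C.CH (U d ℓ₁ (m + 1)) (Mup m) - C.CH (U d ℓ₁ m) (Mup m)) * T d m ℓ) /
        (T d m ℓ * T d (m + 1) ℓ) := by
    rw [show (d : ℝ) - m = T d (m + 1) ℓ - T d m ℓ by linarith]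
    field_simp
    ring
  rw [key]
  exact div_nonneg (sub_nonneg.2 h) (mul_pos hT hT').le

end

end MDCSR
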